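/- Let r₀, r₁, s₀, s₁ ∈ [1,∞] and θ ∈ [0,1], and define r_θ, s_θ ∈ [1,∞] by 1/r_θ = (1−θ)/r₀ + θ/r₁ and 1/s_θ = (1−θ)/s₀ + θ/s₁ (with the convention 1/∞ = 0). Let C := max{ C_{r₀}·C_{s₀′}, C_{r₁}·C_{s₁′} }, where t′ denotes the conjugate exponent of t. Then for every real-linear map T on the real vector space H_n of n×n complex Hermitian matrices one has ‖T‖_{r_θ→s_θ} ≤ C · ‖T‖_{r₀→s₀}^{1−θ} · ‖T‖_{r₁→s₁}^{θ}. -/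

import Mathlib

open scoped ENNReal

/-- The spectral `p`-norm of a Hermitian matrix: the `p`-norm of its eigenvalue vector.
(Junk value `0` for non-Hermitian matrices.) -/
noncomputable def specPNorm {n : ℕ} (p : ℝ≥0∞) (A : Matrix (Fin n) (Fin n) ℂ) : ℝ :=
  if hA : A.IsHermitian then
    (if p = ∞ then ⨆ i, |hA.eigenvalues i|
     else (∑ i, |hA.eigenvalues i| ^ p.toReal) ^ (1 / p.toReal))
  else 0

/-- The operator norm of a real-linear map on Hermitian matrices (represented as a real-linear
map on all matrices), from the spectral `r`-norm to the spectral `s`-norm: the supremum of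
`‖T A‖_s / ‖A‖_r` over nonzero Hermitian `A`. -/
noncomputable def hermOpNorm {n : ℕ} (r s : ℝ≥0∞)
    (T : Matrix (Fin n) (Fin n) ℂ →ₗ[ℝ] Matrix (Fin n) (Fin n) ℂ) : ℝ :=
  ⨆ A : {A : Matrix (Fin n) (Fin n) ℂ // A.IsHermitian ∧ A ≠ 0},
    specPNorm s (T A.1) / specPNorm r A.1


/-- The constant `C_p`: `√2` for `1 ≤ p ≤ 2` and `2^(1/q)` (with `q` the conjugate exponent
of `p`, so `1/q = 1 - 1/p`) for `2 ≤ p ≤ ∞`. -/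
noncomputable def Cp (p : ℝ≥0∞) : ℝ :=
  if p ≤ 2 then Real.sqrt 2 else (2 : ℝ) ^ (1 - 1/p).toReal


open Complex.HadamardThreeLines

section RecipNorm

variable {ι κ : Type*} [Fintype ι] [Fintype κ]

/-- The `ℓ^p` norm of a real vector, expressed through the reciprocal exponent `α = 1 / p`. -/
noncomputable def recipNorm (α : ℝ) (x : ι → ℝ) : ℝ :=
  if α = 0 then ⨆ i, |x i| else (∑ i, |x i| ^ (1 / α)) ^ α

lemma recipNorm_nonneg (α : ℝ) (x : ι → ℝ) : 0 ≤ recipNorm α x := by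
  unfold recipNorm
  split_ifs
  · exact Real.iSup_nonneg fun i => abs_nonneg _
  · positivity

lemma abs_apply_le_recipNorm {α : ℝ} (hα : 0 ≤ α) (x : ι → ℝ) (i : ι) :
    |x i| ≤ recipNorm α x := by
  unfold recipNorm
  split_ifs with h
  · exact le_ciSup (f := fun i => |x i|) (Set.finite_range _).bddAbove i
  · calc |x i| = (|x i| ^ (1 / α)) ^ α := by
          rw [← Real.rpow_mul (abs_nonneg _), one_div_mul_cancel h, Real.rpow_one]
      _ ≤ _ := by
          gcongr
          exact Finset.single_le_sum (f := fun i => |x i| ^ (1 / α))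
            (fun j _ => by positivity) (Finset.mem_univ i)

lemma recipNorm_smul {α : ℝ} {c : ℝ} (hc : 0 ≤ c) (x : ι → ℝ) :
    recipNorm α (c • x) = c * recipNorm α x := by
  unfold recipNorm
  split_ifs with h
  · simp only [Pi.smul_apply, smul_eq_mul, abs_mul, abs_of_nonneg hc]
    rw [Real.mul_iSup_of_nonneg hc]
  · simp only [Pi.smul_apply, smul_eq_mul, abs_mul, abs_of_nonneg hc]
    simp_rw [Real.mul_rpow hc (abs_nonneg _)]
    rw [← Finset.mul_sum, Real.mul_rpow (by positivity) (by positivity),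
      ← Real.rpow_mul hc, one_div_mul_cancel h, Real.rpow_one]

/-- A vector lies in the unit ball as soon as it is dominated by a power of a subprobability
vector. -/
lemma recipNorm_le_one {α : ℝ} (hα : 0 ≤ α) {x w : ι → ℝ} (hw : ∀ i, 0 ≤ w i)
    (hsum : ∑ i, w i ≤ 1) (hx : ∀ i, |x i| ≤ w i ^ α) : recipNorm α x ≤ 1 := by
  unfold recipNorm
  split_ifs with h
  · subst h
    exact Real.iSup_le (fun i => by simpa using hx i) zero_le_one
  · refine Real.rpow_le_one (by positivity) (le_trans ?_ hsum) hα
    gcongr with i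
    calc |x i| ^ (1 / α) ≤ (w i ^ α) ^ (1 / α) := by gcongr; exact hx i
      _ = w i := by rw [← Real.rpow_mul (hw i), mul_one_div_cancel h, Real.rpow_one]

/-- Every vector of the unit ball is dominated by a power of a subprobability vector. -/
lemma exists_weight {α : ℝ} (hα : 0 ≤ α) {x : ι → ℝ} (hx : recipNorm α x ≤ 1) :
    ∃ w : ι → ℝ, (∀ i, 0 ≤ w i) ∧ ∑ i, w i ≤ 1 ∧ (∀ i, |x i| ≤ w i ^ α) ∧
      ∀ i, x i ≠ 0 → 0 < w i := by
  rcases eq_or_ne α 0 with rfl | h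
  · refine ⟨fun _ => (Fintype.card ι : ℝ)⁻¹, fun i => by positivity, ?_, fun i => ?_,
      fun i _ => ?_⟩
    · simpa using mul_inv_le_one
    · simpa using (abs_apply_le_recipNorm le_rfl x i).trans hx
    · have : Nonempty ι := ⟨i⟩
      positivity
  · refine ⟨fun i => |x i| ^ (1 / α), fun i => by positivity, ?_, fun i => ?_,
      fun i hi => by positivity⟩
    · by_contra! hlt
      refine absurd hx (not_le.2 ?_)
      rw [recipNorm, if_neg h]
      exact Real.one_lt_rpow hlt (lt_of_le_of_ne hα h.symm)
    · rw [← Real.rpow_mul (abs_nonneg _), one_div_mul_cancel h, Real.rpow_one]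

/-- Hölder's inequality with respect to a doubly substochastic matrix, on unit balls. -/
lemma sum_mul_le_one {α : ℝ} (hα0 : 0 ≤ α) (hα1 : α ≤ 1) {W : ι → κ → ℝ}
    (hW : ∀ i j, 0 ≤ W i j) (hrow : ∀ i, ∑ j, W i j ≤ 1) (hcol : ∀ j, ∑ i, W i j ≤ 1)
    {x : ι → ℝ} {y : κ → ℝ} (hx : recipNorm α x ≤ 1) (hy : recipNorm (1 - α) y ≤ 1) :
    ∑ i, ∑ j, x i * y j * W i j ≤ 1 := by
  obtain ⟨u, hu0, hu, hxu, -⟩ := exists_weight hα0 hx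
  obtain ⟨v, hv0, hv, hyv, -⟩ := exists_weight (sub_nonneg.2 hα1) hy
  calc ∑ i, ∑ j, x i * y j * W i j
      ≤ ∑ i, ∑ j, (α * u i + (1 - α) * v j) * W i j := by
        gcongr with i _ j
        · exact hW i j
        · calc x i * y j ≤ |x i| * |y j| := by rw [← abs_mul]; exact le_abs_self _
            _ ≤ u i ^ α * v j ^ (1 - α) := by
              gcongr
              · exact Real.rpow_nonneg (hu0 i) _
              · exact hxu i
              · exact hyv j
            _ ≤ _ := Real.geom_mean_le_arith_mean2_weighted hα0 (sub_nonneg.2 hα1) (hu0 i)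
              (hv0 j) (by ring)
    _ = α * ∑ i, u i * ∑ j, W i j + (1 - α) * ∑ j, v j * ∑ i, W i j := by
        simp_rw [add_mul, Finset.sum_add_distrib, Finset.mul_sum]
        congr 1
        · simp_rw [mul_assoc]
        · rw [Finset.sum_comm]
          simp_rw [mul_assoc]
    _ ≤ α * ∑ i, u i * 1 + (1 - α) * ∑ j, v j * 1 := by
        gcongr with i _ j
        · exact hu0 i
        · exact hrow i
        · exact hv0 j
        · exact hcol j
    _ ≤ α * 1 + (1 - α) * 1 := by
        simp only [mul_one]
        nlinarith
    _ = 1 := by ring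

/-- The norm is attained by a functional in the dual unit ball. -/
lemma exists_dual {α : ℝ} (hα : 0 ≤ α) (hα1 : α ≤ 1) (t : ι → ℝ) :
    ∃ y : ι → ℝ, recipNorm (1 - α) y ≤ 1 ∧ ∑ i, t i * y i = recipNorm α t := by
  classical
  by_cases ht : recipNorm α t = 0
  · refine ⟨0, recipNorm_le_one (w := 0) (sub_nonneg.2 hα1) (by simp) (by simp) fun i => ?_,
      by simp [ht]⟩
    simpa using Real.rpow_nonneg le_rfl _
  rcases eq_or_ne α 0 with rfl | h
  · have : Nonempty ι := by
      by_contra hne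
      rw [not_nonempty_iff] at hne
      simp [recipNorm] at ht
    obtain ⟨k, hk⟩ := exists_eq_ciSup_of_finite (f := fun i => |t i|)
    refine ⟨Pi.single k (SignType.sign (t k) : ℝ), recipNorm_le_one (w := Pi.single k 1)
      (by norm_num) (fun i => ?_) (by simp) (fun i => ?_), ?_⟩
    · rcases eq_or_ne i k with rfl | hik <;> simp [*]
    · rcases eq_or_ne i k with rfl | hik
      · rcases lt_trichotomy (t i) 0 with h | h | h <;> simp [h]
      · simp [hik]
    · simp [Pi.single_apply, recipNorm, ← hk]
  · have hS0 : 0 ≤ ∑ i, |t i| ^ (1 / α) := by positivity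
    have hS : 0 < ∑ i, |t i| ^ (1 / α) := by
      refine lt_of_le_of_ne hS0 fun h0 => ht ?_
      rw [recipNorm, if_neg h, ← h0, Real.zero_rpow h]
    set S := ∑ i, |t i| ^ (1 / α) with hSdef
    refine ⟨fun i => (SignType.sign (t i) : ℝ) * (|t i| ^ (1 / α) / S) ^ (1 - α),
      recipNorm_le_one (w := fun i => |t i| ^ (1 / α) / S) (sub_nonneg.2 hα1)
        (fun i => by positivity) ?_ (fun i => ?_), ?_⟩
    · rw [← Finset.sum_div, div_self hS.ne']
    · rw [abs_mul, abs_of_nonneg (a := (_ : ℝ) ^ (1 - α)) (by positivity)]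
      refine mul_le_of_le_one_left (by positivity) ?_
      rcases lt_trichotomy (t i) 0 with h | h | h <;> simp [h]
    · have key : ∀ i, t i * ((SignType.sign (t i) : ℝ) * (|t i| ^ (1 / α) / S) ^ (1 - α))
          = |t i| ^ (1 / α) / S ^ (1 - α) := by
        intro i
        rw [← mul_assoc, self_mul_sign]
        rcases eq_or_ne (t i) 0 with h0 | h0
        · simp [h0, Real.zero_rpow (inv_ne_zero h)]
        · rw [Real.div_rpow (by positivity) hS0, ← Real.rpow_mul (abs_nonneg _), ← mul_div_assoc]
          congr 1
          nth_rewrite 1 [← Real.rpow_one |t i|]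
          rw [← Real.rpow_add (abs_pos.2 h0)]
          congr 1
          field_simp
          ring
      simp_rw [key]
      rw [← Finset.sum_div, ← hSdef, recipNorm, if_neg h, ← hSdef]
      nth_rewrite 1 [← Real.rpow_one S]
      rw [← Real.rpow_sub hS]
      congr 1
      ring

end RecipNorm

section Bilinear

variable {ι κ : Type*} [Fintype ι] [Fintype κ]

/-- Complexifying a real bilinear form at most doubles its bound on a product of boxes. -/
lemma norm_complex_bilin_le {K : ι → κ → ℝ} {u : ι → ℝ} {v : κ → ℝ} {M : ℝ}
    (h : ∀ (a : ι → ℝ) (b : κ → ℝ), (∀ i, |a i| ≤ u i) → (∀ j, |b j| ≤ v j) →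
      ∑ i, ∑ j, a i * b j * K i j ≤ M)
    {x : ι → ℂ} {y : κ → ℂ} (hx : ∀ i, ‖x i‖ ≤ u i) (hy : ∀ j, ‖y j‖ ≤ v j) :
    ‖∑ i, ∑ j, x i * y j * (K i j : ℂ)‖ ≤ 2 * M := by
  set s := ∑ i, ∑ j, x i * y j * (K i j : ℂ) with hs
  obtain ⟨c, hc, hcs⟩ : ∃ c : ℂ, ‖c‖ = 1 ∧ (‖s‖ : ℂ) = c * s := by
    obtain ⟨c, hc, hcs⟩ := RCLike.exists_norm_eq_mul_self s
    exact ⟨c, hc, hcs⟩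
  have hcx : ∀ i, ‖c * x i‖ ≤ u i := fun i => by simpa [hc] using hx i
  have h1 := h (fun i => (c * x i).re) (fun j => (y j).re)
    (fun i => (Complex.abs_re_le_norm _).trans (hcx i))
    (fun j => (Complex.abs_re_le_norm _).trans (hy j))
  have h2 := h (fun i => -(c * x i).im) (fun j => (y j).im)
    (fun i => by rw [abs_neg]; exact (Complex.abs_im_le_norm _).trans (hcx i))
    (fun j => (Complex.abs_im_le_norm _).trans (hy j))
  have h3 : ‖s‖ = ∑ i, ∑ j, (c * x i).re * (y j).re * K i j
      + ∑ i, ∑ j, -(c * x i).im * (y j).im * K i j := by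
    rw [← Complex.ofReal_re ‖s‖, hcs, hs]
    simp_rw [Finset.mul_sum, Complex.re_sum, ← Finset.sum_add_distrib]
    refine Finset.sum_congr rfl fun i _ => Finset.sum_congr rfl fun j _ => ?_
    rw [show c * (x i * y j * (K i j : ℂ)) = c * x i * y j * (K i j : ℂ) by ring,
      Complex.re_mul_ofReal, Complex.mul_re (c * x i)]
    ring
  linarith

/-- A real vector in the unit ball of an intermediate `ℓ^p` space is the value at `θ` of an entire
family whose restriction to `re z = σ` stays in the unit ball of the `σ`-th space. -/
lemma exists_analytic_family {α₀ α₁ θ : ℝ} (hα : 0 ≤ (1 - θ) * α₀ + θ * α₁) {x : ι → ℝ}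
    (hx : recipNorm ((1 - θ) * α₀ + θ * α₁) x ≤ 1) :
    ∃ (F : ℂ → ι → ℂ) (w : ι → ℝ), (∀ i, Differentiable ℂ fun z => F z i) ∧
      (∀ i, F θ i = x i) ∧ (∀ i, 0 ≤ w i) ∧ ∑ i, w i ≤ 1 ∧
      ∀ z i, ‖F z i‖ ≤ w i ^ ((1 - z.re) * α₀ + z.re * α₁) := by
  obtain ⟨w, hw0, hw, hxw, hpos⟩ := exists_weight hα hx
  refine ⟨fun z i => x i * Complex.exp (Real.log (w i) * ((z - θ) * (α₁ - α₀ : ℝ))), w,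
    fun i => by fun_prop, fun i => by simp, hw0, hw, fun z i => ?_⟩
  rcases eq_or_ne (x i) 0 with h0 | h0
  · simpa [h0] using Real.rpow_nonneg (hw0 i) _
  · have hexp : ‖Complex.exp (Real.log (w i) * ((z - θ) * (α₁ - α₀ : ℝ)))‖
        = w i ^ ((z.re - θ) * (α₁ - α₀)) := by
      rw [Complex.norm_exp, Real.rpow_def_of_pos (hpos i h0), Complex.re_ofReal_mul,
        Complex.re_mul_ofReal, Complex.sub_re, Complex.ofReal_re]
    rw [norm_mul, hexp, Complex.norm_real, Real.norm_eq_abs]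
    calc _ ≤ w i ^ ((1 - θ) * α₀ + θ * α₁) * w i ^ ((z.re - θ) * (α₁ - α₀)) := by
          gcongr
          · exact Real.rpow_nonneg (hw0 i) _
          · exact hxw i
      _ = _ := by
          rw [← Real.rpow_add (hpos i h0)]
          congr 1
          ring

/-- Riesz–Thorin interpolation for real bilinear forms, with constant `2`. -/
lemma bilin_interpolation {α₀ α₁ β₀ β₁ θ M₀ M₁ : ℝ} (hα₀ : 0 ≤ α₀) (hα₁ : 0 ≤ α₁)
    (hβ₀ : 0 ≤ β₀) (hβ₁ : 0 ≤ β₁) (hθ0 : 0 ≤ θ) (hθ1 : θ ≤ 1) (hM₀ : 0 ≤ M₀) (hM₁ : 0 ≤ M₁)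
    {K : ι → κ → ℝ}
    (h0 : ∀ (a : ι → ℝ) (b : κ → ℝ), recipNorm α₀ a ≤ 1 → recipNorm β₀ b ≤ 1 →
      ∑ i, ∑ j, a i * b j * K i j ≤ M₀)
    (h1 : ∀ (a : ι → ℝ) (b : κ → ℝ), recipNorm α₁ a ≤ 1 → recipNorm β₁ b ≤ 1 →
      ∑ i, ∑ j, a i * b j * K i j ≤ M₁)
    {a : ι → ℝ} {b : κ → ℝ} (ha : recipNorm ((1 - θ) * α₀ + θ * α₁) a ≤ 1)
    (hb : recipNorm ((1 - θ) * β₀ + θ * β₁) b ≤ 1) :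
    ∑ i, ∑ j, a i * b j * K i j ≤ 2 * M₀ ^ (1 - θ) * M₁ ^ θ := by
  have hθ' : 0 ≤ 1 - θ := sub_nonneg.2 hθ1
  obtain ⟨F, u, hF, hFθ, hu0, hu, hFu⟩ := exists_analytic_family (by positivity) ha
  obtain ⟨G, v, hG, hGθ, hv0, hv, hGv⟩ := exists_analytic_family (by positivity) hb
  have hu1 : ∀ i, u i ≤ 1 := fun i =>
    (Finset.single_le_sum (fun j _ => hu0 j) (Finset.mem_univ i)).trans hu
  have hv1 : ∀ i, v i ≤ 1 := fun i =>
    (Finset.single_le_sum (fun j _ => hv0 j) (Finset.mem_univ i)).trans hv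
  let f : ℂ → ℂ := fun z => ∑ i, ∑ j, F z i * G z j * (K i j : ℂ)
  have hf : Differentiable ℂ f := by
    unfold f
    fun_prop
  have hbdd : BddAbove ((norm ∘ f) '' verticalClosedStrip 0 1) := by
    refine ⟨∑ i, ∑ j, |K i j|, ?_⟩
    rintro _ ⟨z, hz, rfl⟩
    have hz0 : 0 ≤ z.re := hz.1
    have hz1 : 0 ≤ 1 - z.re := sub_nonneg.2 hz.2
    refine (norm_sum_le _ _).trans (Finset.sum_le_sum fun i _ =>
      (norm_sum_le _ _).trans (Finset.sum_le_sum fun j _ => ?_))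
    rw [norm_mul, norm_mul, Complex.norm_real, Real.norm_eq_abs]
    refine mul_le_of_le_one_left (abs_nonneg _) (mul_le_one₀ ?_ (norm_nonneg _) ?_)
    · exact (hFu z i).trans (Real.rpow_le_one (hu0 i) (hu1 i) (by positivity))
    · exact (hGv z j).trans (Real.rpow_le_one (hv0 j) (hv1 j) (by positivity))
  have hleft : ∀ z ∈ Complex.re ⁻¹' {0}, ‖f z‖ ≤ 2 * M₀ := by
    intro z hz
    have hz : z.re = 0 := hz
    refine norm_complex_bilin_le (u := fun i => u i ^ α₀) (v := fun j => v j ^ β₀)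
      (fun a b ha hb => h0 a b (recipNorm_le_one hα₀ hu0 hu ha) (recipNorm_le_one hβ₀ hv0 hv hb))
      (fun i => ?_) (fun j => ?_)
    · simpa [hz] using hFu z i
    · simpa [hz] using hGv z j
  have hright : ∀ z ∈ Complex.re ⁻¹' {1}, ‖f z‖ ≤ 2 * M₁ := by
    intro z hz
    have hz : z.re = 1 := hz
    refine norm_complex_bilin_le (u := fun i => u i ^ α₁) (v := fun j => v j ^ β₁)
      (fun a b ha hb => h1 a b (recipNorm_le_one hα₁ hu0 hu ha) (recipNorm_le_one hβ₁ hv0 hv hb))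
      (fun i => ?_) (fun j => ?_)
    · simpa [hz] using hFu z i
    · simpa [hz] using hGv z j
  have hmain := norm_le_interp_of_mem_verticalClosedStrip₀₁' f (z := (θ : ℂ))
    ⟨hθ0, hθ1⟩ hf.diffContOnCl hbdd hleft hright
  have hfθ : f θ = ((∑ i, ∑ j, a i * b j * K i j : ℝ) : ℂ) := by
    simp [f, hFθ, hGθ]
  rw [hfθ, Complex.norm_real, Complex.ofReal_re, Real.mul_rpow zero_le_two hM₀,
    Real.mul_rpow zero_le_two hM₁] at hmain
  calc _ ≤ _ := (le_abs_self _).trans hmain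
    _ = (2 ^ (1 - θ) * 2 ^ θ) * M₀ ^ (1 - θ) * M₁ ^ θ := by ring
    _ = _ := by rw [← Real.rpow_add two_pos, sub_add_cancel, Real.rpow_one]

end Bilinear

section Spectral

open Matrix

variable {n : ℕ}

lemma toReal_inv_le_one {p : ℝ≥0∞} (hp : 1 ≤ p) : (p⁻¹).toReal ≤ 1 :=
  ENNReal.toReal_mono ENNReal.one_ne_top (ENNReal.inv_le_one.2 hp)

lemma specPNorm_eq_recipNorm {p : ℝ≥0∞} (hp : 1 ≤ p) {A : Matrix (Fin n) (Fin n) ℂ}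
    (hA : A.IsHermitian) : specPNorm p A = recipNorm (p⁻¹).toReal hA.eigenvalues := by
  rw [specPNorm, dif_pos hA, recipNorm]
  rcases eq_or_ne p ∞ with rfl | hp'
  · simp
  · have hpos : 0 < p.toReal := ENNReal.toReal_pos (zero_lt_one.trans_le hp).ne' hp'
    rw [if_neg hp', ENNReal.toReal_inv, if_neg (inv_pos.2 hpos).ne', one_div _⁻¹, inv_inv,
      one_div]

/-- The matrix with real eigenvalues `x` in the orthonormal basis given by the columns of `U`. -/
noncomputable def conjDiagonal (U : unitaryGroup (Fin n) ℂ) :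
    (Fin n → ℝ) →ₗ[ℝ] Matrix (Fin n) (Fin n) ℂ where
  toFun x := (U : Matrix (Fin n) (Fin n) ℂ) * diagonal (fun i => (x i : ℂ)) *
    star (U : Matrix (Fin n) (Fin n) ℂ)
  map_add' x y := by
    simp only [Pi.add_apply, Complex.ofReal_add, ← diagonal_add, mul_add, add_mul]
  map_smul' c x := by
    have : diagonal (fun i => (((c • x) i : ℝ) : ℂ)) = c • diagonal (fun i => (x i : ℂ)) := by
      rw [← diagonal_smul]
      congr 1
      ext i
      simp
    rw [this, mul_smul_comm, smul_mul_assoc, RingHom.id_apply]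

lemma conjDiagonal_apply (U : unitaryGroup (Fin n) ℂ) (x : Fin n → ℝ) :
    conjDiagonal U x = (U : Matrix (Fin n) (Fin n) ℂ) * diagonal (fun i => (x i : ℂ)) *
      star (U : Matrix (Fin n) (Fin n) ℂ) := rfl

lemma isHermitian_conjDiagonal (U : unitaryGroup (Fin n) ℂ) (x : Fin n → ℝ) :
    (conjDiagonal U x).IsHermitian := by
  rw [conjDiagonal_apply, star_eq_conjTranspose]
  exact isHermitian_mul_mul_conjTranspose _ (isHermitian_diagonal_of_self_adjoint _ (by
    ext i
    simp))

lemma conjDiagonal_eigenvalues {A : Matrix (Fin n) (Fin n) ℂ} (hA : A.IsHermitian) :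
    conjDiagonal hA.eigenvectorUnitary hA.eigenvalues = A := by
  conv_rhs => rw [hA.spectral_theorem, Unitary.conjStarAlgAut_apply]
  rfl

lemma eigenvalues_conjDiagonal (U : unitaryGroup (Fin n) ℂ) (x : Fin n → ℝ) :
    Finset.univ.val.map (isHermitian_conjDiagonal U x).eigenvalues = Finset.univ.val.map x := by
  have h := (isHermitian_conjDiagonal U x).roots_charpoly_eq_eigenvalues
  have h' : (conjDiagonal U x).charpoly.roots
      = Finset.univ.val.map (fun i => (x i : ℂ)) := by
    rw [conjDiagonal_apply, charpoly_mul_comm, ← mul_assoc, Unitary.coe_star_mul_self, one_mul,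
      charpoly_diagonal, Polynomial.roots_prod _ _ (by
        simp [Finset.prod_ne_zero_iff, Polynomial.X_sub_C_ne_zero])]
    simp
  rw [h'] at h
  have h2 := congrArg (Multiset.map Complex.re) h
  simpa [Function.comp_def] using h2.symm

lemma recipNorm_congr_of_map_eq {α : ℝ} {x y : Fin n → ℝ}
    (h : Finset.univ.val.map x = Finset.univ.val.map y) : recipNorm α x = recipNorm α y := by
  have hsum : ∑ i, |x i| ^ (1 / α) = ∑ i, |y i| ^ (1 / α) := by
    have := congrArg (fun s => (s.map fun t : ℝ => |t| ^ (1 / α)).sum) h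
    simpa [Multiset.map_map, Function.comp_def, Finset.sum] using this
  have hrange : Set.range x = Set.range y := by
    ext t
    have := congrArg (fun s => t ∈ s) h
    simpa using this
  have hsup : ⨆ i, |x i| = ⨆ i, |y i| := by
    rw [iSup, iSup, ← Function.comp_def, ← Function.comp_def, Set.range_comp, Set.range_comp,
      hrange]
  rw [recipNorm, recipNorm, hsum, hsup]

lemma specPNorm_conjDiagonal {p : ℝ≥0∞} (hp : 1 ≤ p) (U : unitaryGroup (Fin n) ℂ)
    (x : Fin n → ℝ) : specPNorm p (conjDiagonal U x) = recipNorm (p⁻¹).toReal x := by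
  rw [specPNorm_eq_recipNorm hp (isHermitian_conjDiagonal U x)]
  exact recipNorm_congr_of_map_eq (eigenvalues_conjDiagonal U x)

lemma re_trace_conjDiagonal_mul (U V : unitaryGroup (Fin n) ℂ) (x y : Fin n → ℝ) :
    (trace (conjDiagonal U x * conjDiagonal V y)).re =
      ∑ i, ∑ j, x i * y j * Complex.normSq ((star U * V : unitaryGroup (Fin n) ℂ).1 i j) := by
  set W : Matrix (Fin n) (Fin n) ℂ := (star U * V : unitaryGroup (Fin n) ℂ).1 with hW
  have h : trace (conjDiagonal U x * conjDiagonal V y) =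
      trace (diagonal (fun i => (x i : ℂ)) * (W * diagonal (fun j => (y j : ℂ)) * Wᴴ)) := by
    have hW' : W = star (U : Matrix (Fin n) (Fin n) ℂ) * (V : Matrix (Fin n) (Fin n) ℂ) := rfl
    rw [conjDiagonal_apply, conjDiagonal_apply, hW', ← star_eq_conjTranspose, star_mul, star_star,
      mul_assoc, mul_assoc, trace_mul_comm]
    simp only [mul_assoc]
  rw [h, trace, Complex.re_sum]
  refine Finset.sum_congr rfl fun i _ => ?_
  rw [diag_apply, diagonal_mul, Matrix.mul_apply, Complex.re_ofReal_mul, Complex.re_sum,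
    Finset.mul_sum]
  refine Finset.sum_congr rfl fun j _ => ?_
  rw [mul_diagonal, conjTranspose_apply, mul_assoc, mul_assoc]
  congr 1
  rw [mul_left_comm, Complex.re_ofReal_mul, Complex.star_def, Complex.mul_conj,
    Complex.ofReal_re]

lemma sum_normSq_row (W : unitaryGroup (Fin n) ℂ) (i : Fin n) :
    ∑ j, Complex.normSq (W.1 i j) = 1 := by
  have h := congrFun (congrFun (Unitary.coe_mul_star_self W) i) i
  rw [Unitary.coe_star, star_eq_conjTranspose, Matrix.mul_apply, one_apply_eq] at h
  simp only [conjTranspose_apply, Complex.star_def, Complex.mul_conj] at h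
  exact_mod_cast h

lemma sum_normSq_col (W : unitaryGroup (Fin n) ℂ) (j : Fin n) :
    ∑ i, Complex.normSq (W.1 i j) = 1 := by
  have h := congrFun (congrFun (Unitary.coe_star_mul_self W) j) j
  rw [star_eq_conjTranspose, Matrix.mul_apply, one_apply_eq] at h
  simp only [conjTranspose_apply, Complex.star_def, mul_comm _ (W.1 _ j), Complex.mul_conj] at h
  exact_mod_cast h

/-- Hölder's inequality for the trace pairing of Hermitian matrices. -/
lemma re_trace_mul_le {p : ℝ≥0∞} (hp : 1 ≤ p) {A : Matrix (Fin n) (Fin n) ℂ}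
    (hA : A.IsHermitian) (V : unitaryGroup (Fin n) ℂ) {y : Fin n → ℝ}
    (hy : recipNorm (1 - (p⁻¹).toReal) y ≤ 1) :
    (trace (A * conjDiagonal V y)).re ≤ specPNorm p A := by
  set α := (p⁻¹).toReal
  have hα0 : 0 ≤ α := ENNReal.toReal_nonneg
  have hα1 : α ≤ 1 := toReal_inv_le_one hp
  have hball : ∀ x : Fin n → ℝ, recipNorm α x ≤ 1 →
      (trace (conjDiagonal hA.eigenvectorUnitary x * conjDiagonal V y)).re ≤ 1 := by
    intro x hx
    rw [re_trace_conjDiagonal_mul]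
    exact sum_mul_le_one hα0 hα1 (fun i j => Complex.normSq_nonneg _)
      (fun i => (sum_normSq_row _ i).le) (fun j => (sum_normSq_col _ j).le) hx hy
  set N := recipNorm α hA.eigenvalues with hN
  have hN0 : 0 ≤ N := recipNorm_nonneg _ _
  rw [specPNorm_eq_recipNorm hp hA, ← hN]
  nth_rewrite 1 [← conjDiagonal_eigenvalues hA]
  rcases hN0.eq_or_lt with h0 | hpos
  · have hz : hA.eigenvalues = 0 := by
      ext i
      simpa [← hN, ← h0] using abs_apply_le_recipNorm hα0 hA.eigenvalues i
    simp [hz, ← h0]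
  · have h := hball (N⁻¹ • hA.eigenvalues) (by
      rw [recipNorm_smul (inv_nonneg.2 hN0), ← hN, inv_mul_cancel₀ hpos.ne'])
    rw [map_smul, smul_mul_assoc, trace_smul, Complex.smul_re, smul_eq_mul] at h
    rwa [inv_mul_le_iff₀ hpos, mul_one] at h

lemma exists_re_trace_eq {p : ℝ≥0∞} (hp : 1 ≤ p) {A : Matrix (Fin n) (Fin n) ℂ}
    (hA : A.IsHermitian) : ∃ y : Fin n → ℝ, recipNorm (1 - (p⁻¹).toReal) y ≤ 1 ∧
      (trace (A * conjDiagonal hA.eigenvectorUnitary y)).re = specPNorm p A := by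
  obtain ⟨y, hy, hsum⟩ := exists_dual (α := (p⁻¹).toReal) ENNReal.toReal_nonneg
    (toReal_inv_le_one hp) hA.eigenvalues
  refine ⟨y, hy, ?_⟩
  rw [specPNorm_eq_recipNorm hp hA, ← hsum]
  nth_rewrite 1 [← conjDiagonal_eigenvalues hA]
  rw [re_trace_conjDiagonal_mul, Unitary.star_mul_self]
  simp [Matrix.one_apply, apply_ite Complex.normSq]

lemma specPNorm_nonneg (p : ℝ≥0∞) (A : Matrix (Fin n) (Fin n) ℂ) : 0 ≤ specPNorm p A := by
  unfold specPNorm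
  split_ifs
  · exact Real.iSup_nonneg fun i => abs_nonneg _
  · positivity
  · rfl

lemma specPNorm_pos {p : ℝ≥0∞} (hp : 1 ≤ p) {A : Matrix (Fin n) (Fin n) ℂ}
    (hA : A.IsHermitian) (h0 : A ≠ 0) : 0 < specPNorm p A := by
  refine lt_of_le_of_ne (specPNorm_nonneg p A) fun h => h0 ?_
  rw [specPNorm_eq_recipNorm hp hA] at h
  rw [← hA.eigenvalues_eq_zero_iff]
  ext i
  have hi := abs_apply_le_recipNorm (α := (p⁻¹).toReal) ENNReal.toReal_nonneg hA.eigenvalues i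
  rw [← h] at hi
  exact abs_nonpos_iff.1 hi

lemma recipNorm_le_of_abs_le {α : ℝ} (hα : 0 ≤ α) {c : ℝ} (hc : 0 ≤ c) {x : Fin n → ℝ}
    (hx : ∀ i, |x i| ≤ c) : recipNorm α x ≤ (n : ℝ) ^ α * c := by
  unfold recipNorm
  split_ifs with h
  · simpa [h] using Real.iSup_le hx hc
  · calc (∑ i, |x i| ^ (1 / α)) ^ α ≤ (∑ _i : Fin n, c ^ (1 / α)) ^ α := by
          gcongr with i
          exact hx i
      _ = _ := by
          rw [Finset.sum_const, Finset.card_univ, Fintype.card_fin, nsmul_eq_mul,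
            Real.mul_rpow (by positivity) (by positivity), ← Real.rpow_mul hc,
            one_div_mul_cancel h, Real.rpow_one]

open scoped Matrix.Norms.L2Operator in
lemma l2_opNorm_eq_norm_eigenvalues {A : Matrix (Fin n) (Fin n) ℂ} (hA : A.IsHermitian) :
    ‖A‖ = ‖hA.eigenvalues‖ := by
  conv_lhs => rw [← conjDiagonal_eigenvalues hA, conjDiagonal_apply, ← Unitary.coe_star,
    CStarRing.norm_mul_coe_unitary, CStarRing.norm_coe_unitary_mul, l2_opNorm_diagonal]
  simp [Pi.norm_def]

open scoped Matrix.Norms.L2Operator in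
lemma bddAbove_specPNorm_ratio {r s : ℝ≥0∞} (hr : 1 ≤ r) (hs : 1 ≤ s)
    {T : Matrix (Fin n) (Fin n) ℂ →ₗ[ℝ] Matrix (Fin n) (Fin n) ℂ}
    (hT : ∀ A : Matrix (Fin n) (Fin n) ℂ, A.IsHermitian → (T A).IsHermitian) :
    BddAbove (Set.range fun A : {A : Matrix (Fin n) (Fin n) ℂ // A.IsHermitian ∧ A ≠ 0} =>
      specPNorm s (T A.1) / specPNorm r A.1) := by
  obtain ⟨C, hC0, hC⟩ := (LinearMap.toContinuousLinearMap T).isBoundedLinearMap.bound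
  refine ⟨(n : ℝ) ^ (s⁻¹).toReal * C, ?_⟩
  rintro _ ⟨⟨A, hA, h0⟩, rfl⟩
  have hN := recipNorm_nonneg (r⁻¹).toReal hA.eigenvalues
  rw [div_le_iff₀ (specPNorm_pos hr hA h0), specPNorm_eq_recipNorm hs (hT A hA),
    specPNorm_eq_recipNorm hr hA, mul_assoc]
  refine recipNorm_le_of_abs_le ENNReal.toReal_nonneg (by positivity) fun i => ?_
  calc |(hT A hA).eigenvalues i| ≤ ‖(hT A hA).eigenvalues‖ :=
        norm_le_pi_norm (hT A hA).eigenvalues i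
    _ = ‖T A‖ := (l2_opNorm_eq_norm_eigenvalues _).symm
    _ ≤ C * ‖A‖ := hC A
    _ ≤ C * recipNorm (r⁻¹).toReal hA.eigenvalues := by
      rw [l2_opNorm_eq_norm_eigenvalues hA]
      gcongr
      exact (pi_norm_le_iff_of_nonneg hN).2 fun i =>
        abs_apply_le_recipNorm ENNReal.toReal_nonneg _ i

lemma hermOpNorm_nonneg (r s : ℝ≥0∞)
    (T : Matrix (Fin n) (Fin n) ℂ →ₗ[ℝ] Matrix (Fin n) (Fin n) ℂ) : 0 ≤ hermOpNorm r s T :=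
  Real.iSup_nonneg fun _ => div_nonneg (specPNorm_nonneg _ _) (specPNorm_nonneg _ _)

lemma specPNorm_apply_le {r s : ℝ≥0∞} (hr : 1 ≤ r) (hs : 1 ≤ s)
    {T : Matrix (Fin n) (Fin n) ℂ →ₗ[ℝ] Matrix (Fin n) (Fin n) ℂ}
    (hT : ∀ A : Matrix (Fin n) (Fin n) ℂ, A.IsHermitian → (T A).IsHermitian)
    {A : Matrix (Fin n) (Fin n) ℂ} (hA : A.IsHermitian) :
    specPNorm s (T A) ≤ hermOpNorm r s T * specPNorm r A := by
  rcases eq_or_ne A 0 with rfl | h0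
  · have h : specPNorm s (0 : Matrix (Fin n) (Fin n) ℂ) = 0 := by
      have hz : (0 : Matrix (Fin n) (Fin n) ℂ).IsHermitian := isHermitian_zero
      refine le_antisymm ?_ (specPNorm_nonneg _ _)
      rw [specPNorm_eq_recipNorm hs hz, hz.eigenvalues_eq_zero_iff.2 rfl]
      simpa using recipNorm_smul (α := (s⁻¹).toReal) le_rfl (0 : Fin n → ℝ) |>.le
    rw [map_zero, h]
    exact mul_nonneg (hermOpNorm_nonneg _ _ _) (specPNorm_nonneg _ _)
  · rw [← div_le_iff₀ (specPNorm_pos hr hA h0)]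
    exact le_ciSup (bddAbove_specPNorm_ratio hr hs hT) ⟨A, hA, h0⟩

end Spectral

lemma sqrt_two_le_Cp (p : ℝ≥0∞) : √2 ≤ Cp p := by
  unfold Cp
  split_ifs with h
  · rfl
  · rw [Real.sqrt_eq_rpow]
    refine Real.rpow_le_rpow_of_exponent_le one_le_two ?_
    have hp : p⁻¹ ≤ 2⁻¹ := ENNReal.inv_le_inv.2 (not_le.1 h).le
    have hp1 : p⁻¹ ≤ 1 := hp.trans (by simp)
    have h2 := ENNReal.toReal_mono (by simp) hp
    rw [one_div p, ENNReal.toReal_sub_of_le hp1 ENNReal.one_ne_top]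
    norm_num at h2 ⊢
    linarith

lemma two_le_Cp_mul_Cp (p q : ℝ≥0∞) : 2 ≤ Cp p * Cp q :=
  calc (2 : ℝ) = √2 * √2 := (Real.mul_self_sqrt zero_le_two).symm
    _ ≤ _ := by
      exact mul_le_mul (sqrt_two_le_Cp p) (sqrt_two_le_Cp q) (Real.sqrt_nonneg _)
        ((Real.sqrt_nonneg _).trans (sqrt_two_le_Cp p))

lemma toReal_inv_interp {p₀ p₁ p : ℝ≥0∞} {θ : ℝ} (hp₀ : 1 ≤ p₀) (hp₁ : 1 ≤ p₁)
    (hθ0 : 0 ≤ θ) (hθ1 : θ ≤ 1)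
    (h : 1 / p = ENNReal.ofReal (1 - θ) / p₀ + ENNReal.ofReal θ / p₁) :
    (p⁻¹).toReal = (1 - θ) * (p₀⁻¹).toReal + θ * (p₁⁻¹).toReal := by
  have hfin : ∀ {q : ℝ≥0∞}, 1 ≤ q → ∀ t : ℝ, ENNReal.ofReal t * q⁻¹ ≠ ∞ := fun hq t =>
    ENNReal.mul_ne_top ENNReal.ofReal_ne_top
      (ENNReal.inv_ne_top.2 (zero_lt_one.trans_le hq).ne')
  rw [← one_div, h, div_eq_mul_inv, div_eq_mul_inv,
    ENNReal.toReal_add (hfin hp₀ _) (hfin hp₁ _), ENNReal.toReal_mul, ENNReal.toReal_mul,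
    ENNReal.toReal_ofReal (sub_nonneg.2 hθ1), ENNReal.toReal_ofReal hθ0]

lemma one_le_of_interp {p₀ p₁ p : ℝ≥0∞} {θ : ℝ} (hp₀ : 1 ≤ p₀) (hp₁ : 1 ≤ p₁)
    (hθ0 : 0 ≤ θ) (hθ1 : θ ≤ 1)
    (h : 1 / p = ENNReal.ofReal (1 - θ) / p₀ + ENNReal.ofReal θ / p₁) : 1 ≤ p := by
  rw [← ENNReal.inv_le_one, ← one_div, h]
  calc _ ≤ ENNReal.ofReal (1 - θ) / 1 + ENNReal.ofReal θ / 1 := by gcongr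
    _ = 1 := by
      rw [div_one, div_one, ← ENNReal.ofReal_add (sub_nonneg.2 hθ1) hθ0, sub_add_cancel,
        ENNReal.ofReal_one]

/-- Riesz–Thorin type interpolation theorem in the Euclidean Jordan algebra of `n×n` complex
Hermitian matrices: `‖T‖_{rθ→sθ} ≤ C ‖T‖_{r₀→s₀}^{1-θ} ‖T‖_{r₁→s₁}^θ` with
`C = max {C_{r₀} C_{s₀'}, C_{r₁} C_{s₁'}}`, where `s₀', s₁'` are conjugate exponents. -/
theorem riesz_thorin_interpolation_hermitian {n : ℕ} (r₀ r₁ s₀ s₁ s₀' s₁' rθ sθ : ℝ≥0∞)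
    (hr₀ : 1 ≤ r₀) (hr₁ : 1 ≤ r₁) (hs₀ : 1 ≤ s₀) (hs₁ : 1 ≤ s₁)
    (θ : ℝ) (hθ0 : 0 ≤ θ) (hθ1 : θ ≤ 1)
    (hs₀' : 1 / s₀ + 1 / s₀' = 1) (hs₁' : 1 / s₁ + 1 / s₁' = 1)
    (hrθ : 1 / rθ = ENNReal.ofReal (1 - θ) / r₀ + ENNReal.ofReal θ / r₁)
    (hsθ : 1 / sθ = ENNReal.ofReal (1 - θ) / s₀ + ENNReal.ofReal θ / s₁)
    (T : Matrix (Fin n) (Fin n) ℂ →ₗ[ℝ] Matrix (Fin n) (Fin n) ℂ)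
    (hT : ∀ A : Matrix (Fin n) (Fin n) ℂ, A.IsHermitian → (T A).IsHermitian) :
    hermOpNorm rθ sθ T ≤
      max (Cp r₀ * Cp s₀') (Cp r₁ * Cp s₁') *
        hermOpNorm r₀ s₀ T ^ (1 - θ) * hermOpNorm r₁ s₁ T ^ θ := by
  have hrθ1 := one_le_of_interp hr₀ hr₁ hθ0 hθ1 hrθ
  have hsθ1 := one_le_of_interp hs₀ hs₁ hθ0 hθ1 hsθ
  have hα := toReal_inv_interp hr₀ hr₁ hθ0 hθ1 hrθ
  have hβ := toReal_inv_interp hs₀ hs₁ hθ0 hθ1 hsθ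
  have hM₀ := hermOpNorm_nonneg r₀ s₀ T
  have hM₁ := hermOpNorm_nonneg r₁ s₁ T
  have hC : 2 ≤ max (Cp r₀ * Cp s₀') (Cp r₁ * Cp s₁') := le_max_of_le_left (two_le_Cp_mul_Cp _ _)
  suffices h : hermOpNorm rθ sθ T ≤
      2 * hermOpNorm r₀ s₀ T ^ (1 - θ) * hermOpNorm r₁ s₁ T ^ θ from h.trans (by gcongr)
  refine Real.iSup_le ?_ (by positivity)
  rintro ⟨A, hA, hA0⟩
  have hpos := specPNorm_pos hrθ1 hA hA0
  obtain ⟨y, hy, hytr⟩ := exists_re_trace_eq hsθ1 (hT A hA)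
  set U := hA.eigenvectorUnitary
  set V := (hT A hA).eigenvectorUnitary
  let K : Fin n → Fin n → ℝ := fun i j =>
    (Matrix.trace (T (conjDiagonal U fun k => if i = k then 1 else 0) *
      conjDiagonal V fun k => if j = k then 1 else 0)).re
  have hK : ∀ a b : Fin n → ℝ, ∑ i, ∑ j, a i * b j * K i j =
      (Matrix.trace (T (conjDiagonal U a) * conjDiagonal V b)).re := by
    intro a b
    rw [(conjDiagonal U).pi_apply_eq_sum_univ a, (conjDiagonal V).pi_apply_eq_sum_univ b]
    simp only [map_sum, map_smul, Finset.sum_mul, Finset.mul_sum, Matrix.trace_sum,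
      Complex.re_sum, smul_mul_assoc, mul_smul_comm, Matrix.trace_smul, Complex.smul_re,
      smul_eq_mul, K]
    rw [Finset.sum_comm]
    exact Finset.sum_congr rfl fun j _ => Finset.sum_congr rfl fun i _ => by ring
  have hbound : ∀ {r s : ℝ≥0∞}, 1 ≤ r → 1 ≤ s → ∀ a b : Fin n → ℝ,
      recipNorm (r⁻¹).toReal a ≤ 1 → recipNorm (1 - (s⁻¹).toReal) b ≤ 1 →
      ∑ i, ∑ j, a i * b j * K i j ≤ hermOpNorm r s T := by
    intro r s hr hs a b ha hb
    rw [hK]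
    have hH := isHermitian_conjDiagonal U a
    refine (re_trace_mul_le hs (hT _ hH) V hb).trans ((specPNorm_apply_le hr hs hT hH).trans ?_)
    rw [specPNorm_conjDiagonal hr]
    exact mul_le_of_le_one_right (hermOpNorm_nonneg _ _ _) ha
  have hinv : ∀ {p : ℝ≥0∞}, 1 ≤ p → 0 ≤ 1 - (p⁻¹).toReal := fun hp => 
    sub_nonneg.2 (toReal_inv_le_one hp)
  have hmain := bilin_interpolation ENNReal.toReal_nonneg ENNReal.toReal_nonneg (hinv hs₀)
    (hinv hs₁) hθ0 hθ1 hM₀ hM₁ (hbound hr₀ hs₀) (hbound hr₁ hs₁)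
    (a := (specPNorm rθ A)⁻¹ • hA.eigenvalues) (b := y)
    (by rw [← hα, recipNorm_smul (inv_nonneg.2 hpos.le), ← specPNorm_eq_recipNorm hrθ1 hA,
      inv_mul_cancel₀ hpos.ne'])
    (by convert hy using 2; rw [hβ]; ring)
  rw [hK, map_smul, conjDiagonal_eigenvalues, map_smul, smul_mul_assoc, Matrix.trace_smul,
    Complex.smul_re, smul_eq_mul, hytr, inv_mul_eq_div] at hmain
  exact hmain
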